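/- Let I ⊂ ℝ be an interval, X a Banach space, and (v_n) ⊂ L¹(I, X) a sequence of Bochner integrable maps. Suppose there exist m ∈ L¹(I, ℝ₊) and a family (K_t)_{t ∈ I} of weakly compact subsets of X such that ‖v_n(t)‖_X ≤ m(t) and v_n(t) ∈ K_t for a.e. t and all n. Then some subsequence (v_{n_k}) converges weakly in L¹(I, X) to a limit v ∈ L¹(I, X); in particular ∫_I ⟨φ(t), v(t) − v_{n_k}(t)⟩ dt → 0 for every φ ∈ L^∞(I, X*). -/

import Mathlib

open MeasureTheory Set Filter
open scoped Topology

noncomputable section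


theorem aux_sep (Y : Type*) [NormedAddCommGroup Y] [NormedSpace ℝ Y]
    [SecondCountableTopology Y] :
    ∃ d : ℕ → StrongDual ℝ Y, (∀ j, ‖d j‖ ≤ 1) ∧ ∀ y, (∀ j, d j y = 0) → y = 0 := by
  choose s hs using fun j => exists_dual_vector'' ℝ (TopologicalSpace.denseSeq Y j)
  refine ⟨s, fun j => (hs j).1, fun a ha => ?_⟩
  by_contra hne
  have a_pos : 0 < ‖a‖ := norm_pos_iff.2 hne
  obtain ⟨j, hj⟩ := (TopologicalSpace.denseRange_denseSeq Y).exists_dist_lt a (half_pos a_pos)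
  set x := TopologicalSpace.denseSeq Y j with hx
  have h1 : ‖a‖ ≤ ‖x‖ + ‖a - x‖ := norm_le_insert' _ _
  rw [dist_eq_norm] at hj
  have h2 : ‖s j x‖ = ‖x‖ := by rw [hx, (hs j).2]; simp
  have h3 : s j x = s j (x - a) := by simp [ha j]
  have h4 : ‖s j (x - a)‖ ≤ 1 * ‖x - a‖ := ContinuousLinearMap.le_of_opNorm_le _ (hs j).1 _
  rw [← h3, h2, norm_sub_rev] at h4
  linarith

theorem aux_meas {α Y : Type*} [MeasurableSpace α] [NormedAddCommGroup Y] [NormedSpace ℝ Y]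
    [CompleteSpace Y] [SecondCountableTopology Y] [MeasurableSpace Y] [BorelSpace Y]
    (d : ℕ → StrongDual ℝ Y) (hd : ∀ y, (∀ j, d j y = 0) → y = 0) (f : α → Y)
    (hf : ∀ j, Measurable fun a => d j (f a)) : Measurable f := by
  have hE : Continuous (fun y : Y => fun j => d j y) := by fun_prop
  have hi : Function.Injective (fun y : Y => fun j => d j y) := by
    intro y z h
    rw [← sub_eq_zero]
    refine hd _ fun j => ?_
    have := congrFun h j
    simp only at this
    simp [this]
  refine (hE.measurableEmbedding hi).measurable_comp_iff.1 ?_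
  exact measurable_pi_iff.2 hf

theorem aux_KS {Z Y : Type*} [TopologicalSpace Z] [CompactSpace Z] [T2Space Z]
    [NormedAddCommGroup Y] [NormedSpace ℝ Y]
    [CompleteSpace Y] [SecondCountableTopology Y]
    (f : Z → Y) (M : ℝ) (hM : ∀ z, ‖f z‖ ≤ M)
    (hc : ∀ y' : StrongDual ℝ Y, Continuous fun z => y' (f z)) :
    ∃ C : Set (WeakSpace ℝ Y), IsCompact C ∧
      ∀ u ∈ convexHull ℝ (range f), toWeakSpace ℝ Y u ∈ C := by
  let : MeasurableSpace Z := borel Z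
  have : BorelSpace Z := ⟨rfl⟩
  let : MeasurableSpace Y := borel Y
  have : BorelSpace Y := ⟨rfl⟩
  obtain ⟨d, hd1, hd⟩ := aux_sep Y
  have hfm : Measurable f := aux_meas d hd f fun j => (hc (d j)).measurable
  have hint : ∀ μ : Measure Z, IsFiniteMeasure μ → Integrable f μ := fun μ _ =>
    Integrable.of_bound hfm.aestronglyMeasurable M (Eventually.of_forall hM)
  let b : ProbabilityMeasure Z → WeakSpace ℝ Y := fun μ => toWeakSpace ℝ Y (∫ z, f z ∂(μ : Measure Z))
  have hb : Continuous b := by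
    refine WeakBilin.continuous_of_continuous_eval _ fun y' => ?_
    let F : BoundedContinuousFunction Z ℝ := BoundedContinuousFunction.mkOfCompact ⟨_, hc y'⟩
    have : ∀ μ : ProbabilityMeasure Z, y' (∫ z, f z ∂(μ : Measure Z)) = ∫ z, F z ∂(μ : Measure Z) := by
      intro μ
      exact (ContinuousLinearMap.integral_comp_comm y' (hint _ inferInstance)).symm
    have h2 : Continuous fun μ : ProbabilityMeasure Z => ∫ z, F z ∂(μ : Measure Z) := by
      rw [continuous_iff_continuousAt]
      intro μ
      exact (ProbabilityMeasure.tendsto_iff_forall_integral_tendsto.1 tendsto_id) F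
    exact h2.congr fun μ => (this μ).symm
  refine ⟨range b, isCompact_range hb, ?_⟩
  have hconv : Convex ℝ {u : Y | toWeakSpace ℝ Y u ∈ range b} := by
    rintro x ⟨μ, hμ⟩ y ⟨ν, hν⟩ p q hp hq hpq
    replace hμ : ∫ z, f z ∂(μ : Measure Z) = x := (toWeakSpace ℝ Y).injective hμ
    replace hν : ∫ z, f z ∂(ν : Measure Z) = y := (toWeakSpace ℝ Y).injective hν
    let ρ : Measure Z := ENNReal.ofReal p • (μ : Measure Z) + ENNReal.ofReal q • (ν : Measure Z)
    have hρ : IsProbabilityMeasure ρ := ⟨by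
      simp [ρ, ← ENNReal.ofReal_add hp hq, hpq]⟩
    refine ⟨⟨ρ, hρ⟩, ?_⟩
    change toWeakSpace ℝ Y (∫ z, f z ∂ρ) = _
    congr 1
    rw [integral_add_measure, integral_smul_measure, integral_smul_measure, hμ, hν]
    · simp [ENNReal.toReal_ofReal, hp, hq]
    · exact (hint _ inferInstance).smul_measure ENNReal.ofReal_ne_top
    · exact (hint _ inferInstance).smul_measure ENNReal.ofReal_ne_top
  refine fun u hu => convexHull_min ?_ hconv hu
  rintro _ ⟨z, rfl⟩
  refine ⟨⟨Measure.dirac z, inferInstance⟩, ?_⟩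
  change toWeakSpace ℝ Y (∫ z, f z ∂(Measure.dirac z)) = _
  rw [integral_dirac' _ _ hfm.stronglyMeasurable]

theorem aux_lim {Y : Type*} [NormedAddCommGroup Y] [NormedSpace ℝ Y]
    (d : ℕ → StrongDual ℝ Y) (hd : ∀ y, (∀ j, d j y = 0) → y = 0)
    (C : Set (WeakSpace ℝ Y)) (hC : IsCompact C) (u : ℕ → Y) (hu : ∀ k, toWeakSpace ℝ Y (u k) ∈ C)
    (hl : ∀ j, ∃ l, Tendsto (fun k => d j (u k)) atTop (𝓝 l)) :
    ∃ w, ∀ y' : StrongDual ℝ Y, Tendsto (fun k => y' (u k)) atTop (𝓝 (y' w)) := by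
  have hev : ∀ y' : StrongDual ℝ Y, Continuous fun x : WeakSpace ℝ Y => y' ((toWeakSpace ℝ Y).symm x) :=
    fun y' => WeakBilin.eval_continuous (topDualPairing ℝ Y).flip y'
  obtain ⟨x, hxC, hx⟩ := hC.exists_mapClusterPt (f := atTop) (u := fun k => toWeakSpace ℝ Y (u k))
    (by simp; exact ⟨0, fun b _ => hu b⟩)
  have huniq : ∀ y ∈ C, MapClusterPt y atTop (fun k => toWeakSpace ℝ Y (u k)) → y = x := by
    intro y _ hy
    apply (toWeakSpace ℝ Y).symm.injective
    rw [← sub_eq_zero]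
    refine hd _ fun j => ?_
    obtain ⟨l, hl⟩ := hl j
    have h1 := hy.tendsto_comp ((hev (d j)).tendsto y)
    have h2 := hx.tendsto_comp ((hev (d j)).tendsto x)
    have e1 := eq_of_nhds_neBot (ClusterPt.mono h1 hl)
    have e2 := eq_of_nhds_neBot (ClusterPt.mono h2 hl)
    rw [map_sub, e1, e2, sub_self]
  have ht : Tendsto (fun k => toWeakSpace ℝ Y (u k)) atTop (𝓝 x) :=
    hC.tendsto_nhds_of_unique_mapClusterPt (Eventually.of_forall hu) huniq
  refine ⟨(toWeakSpace ℝ Y).symm x, fun y' => ?_⟩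
  exact ((hev y').tendsto x).comp ht

theorem aux_hilbert {H : Type*} [NormedAddCommGroup H] [InnerProductSpace ℝ H] [CompleteSpace H]
    (x : ℕ → H) (M : ℝ) (hM : ∀ n, ‖x n‖ ≤ M) :
    ∃ (u : ℕ → H) (p : H), (∀ k, u k ∈ convexHull ℝ (x '' Ici k)) ∧ Tendsto u atTop (𝓝 p) := by
  let S : ℕ → Set H := fun k => convexHull ℝ (x '' Ici k)
  have hSne : ∀ k, (S k).Nonempty := fun k => ⟨x k, subset_convexHull _ _ ⟨k, by simp, rfl⟩⟩
  have hSmono : ∀ k l, k ≤ l → S l ⊆ S k := fun k l h =>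
    convexHull_mono (image_mono (Ici_subset_Ici.2 h))
  let ρ : ℕ → ℝ := fun k => sInf ((fun h => ‖h‖ ^ 2) '' S k)
  have hbdd : ∀ k, BddBelow ((fun h : H => ‖h‖ ^ 2) '' S k) := fun k =>
    ⟨0, by rintro _ ⟨h, _, rfl⟩; positivity⟩
  have hρmono : Monotone ρ := fun k l h =>
    csInf_le_csInf (hbdd k) ((hSne l).image _) (image_mono (hSmono k l h))
  have hρle : ∀ k, ∀ h ∈ S k, ρ k ≤ ‖h‖ ^ 2 := fun k h hh => csInf_le (hbdd k) ⟨h, hh, rfl⟩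
  have hρbd : BddAbove (range ρ) := by
    refine ⟨M ^ 2, ?_⟩
    rintro _ ⟨k, rfl⟩
    refine (hρle k (x k) (subset_convexHull _ _ ⟨k, by simp, rfl⟩)).trans ?_
    gcongr
    exact hM k
  obtain ⟨r, hr⟩ : ∃ r, Tendsto ρ atTop (𝓝 r) := ⟨_, tendsto_atTop_ciSup hρmono hρbd⟩
  have hex : ∀ k : ℕ, ∃ h ∈ S k, ‖h‖ ^ 2 < ρ k + 1 / ((k : ℝ) + 1) := by
    intro k
    obtain ⟨_, ⟨h, hh, rfl⟩, hlt⟩ := exists_lt_of_csInf_lt ((hSne k).image (fun h : H => ‖h‖ ^ 2))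
      (show ρ k < ρ k + 1 / ((k : ℝ) + 1) by
        have : 0 < 1 / ((k : ℝ) + 1) := by positivity
        linarith)
    exact ⟨h, hh, hlt⟩
  choose u huS hu using hex
  have key : ∀ k l, k ≤ l → ‖u k - u l‖ ^ 2 ≤ 2 * (r - ρ k) + 4 * (1 / ((k : ℝ) + 1)) := by
    intro k l hkl
    have hmid : (1 / 2 : ℝ) • u k + (1 / 2 : ℝ) • u l ∈ S k :=
      (convex_convexHull ℝ _) (huS k) (hSmono k l hkl (huS l)) (by norm_num) (by norm_num) (by norm_num)
    have h1 := hρle k _ hmid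
    rw [← smul_add, norm_smul, mul_pow] at h1
    have h2 := parallelogram_law_with_norm ℝ (u k) (u l)
    have h3 : ρ l ≤ r := hρmono.ge_of_tendsto hr l
    have h4 : 1 / ((l : ℝ) + 1) ≤ 1 / ((k : ℝ) + 1) := by
      have : (k : ℝ) ≤ l := by exact_mod_cast hkl
      gcongr
    have h5 := hu k
    have h6 := hu l
    have h7 : ‖(1 / 2 : ℝ)‖ ^ 2 = 1 / 4 := by norm_num
    rw [h7] at h1
    nlinarith
  have hc : CauchySeq u := by
    have ht : Tendsto (fun k : ℕ => √(2 * (r - ρ k) + 4 * (1 / ((k : ℝ) + 1)))) atTop (𝓝 0) := by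
      have := (((tendsto_const_nhds (x := r)).sub hr).const_mul 2).add
        ((tendsto_one_div_add_atTop_nhds_zero_nat (𝕜 := ℝ)).const_mul 4)
      have := (Real.continuous_sqrt.tendsto _).comp this
      simpa [Function.comp_def] using this
    refine cauchySeq_of_le_tendsto_0' _ (fun k l hkl => ?_) ht
    rw [dist_eq_norm]
    exact Real.le_sqrt_of_sq_le (key k l hkl)
  obtain ⟨p, hp⟩ := cauchySeq_tendsto_of_complete hc
  exact ⟨u, p, huS, hp⟩

theorem aux_conv_meas {Y : Type*} [NormedAddCommGroup Y] [NormedSpace ℝ Y]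
    [SecondCountableTopology Y] [MeasurableSpace Y] [BorelSpace Y]
    (s : ℕ → ℝ → Y) (hm : ∀ n, Measurable (s n))
    (hb : ∀ n t, ‖s n t‖ ≤ 1) (k : ℕ) (V : ℝ → Y) (hV : V ∈ convexHull ℝ (s '' Ici k)) :
    Measurable V ∧ (∀ t, ‖V t‖ ≤ 1) ∧ ∀ t, V t ∈ convexHull ℝ (range fun n => s n t) := by
  have hconv : Convex ℝ {V : ℝ → Y | Measurable V ∧ (∀ t, ‖V t‖ ≤ 1) ∧
      ∀ t, V t ∈ convexHull ℝ (range fun n => s n t)} := by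
    rintro V ⟨h1, h2, h3⟩ W ⟨g1, g2, g3⟩ a b ha hb hab
    refine ⟨(h1.const_smul a).add (g1.const_smul b), fun t => ?_, fun t => ?_⟩
    · have := (convex_closedBall (0 : Y) 1) (x := V t) (y := W t) (by simpa using h2 t)
        (by simpa using g2 t) ha hb hab
      simpa using this
    · exact convex_convexHull ℝ _ (h3 t) (g3 t) ha hb hab
  refine convexHull_min ?_ hconv hV
  rintro _ ⟨n, _, rfl⟩
  exact ⟨hm n, hb n, fun t => subset_convexHull _ _ ⟨n, rfl⟩⟩

theorem aux_int {Y : Type*} [NormedAddCommGroup Y] [NormedSpace ℝ Y]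
    [SecondCountableTopology Y] [MeasurableSpace Y] [BorelSpace Y]
    (ν : Measure ℝ) [IsFiniteMeasure ν] (V : ℝ → Y) (hm : Measurable V) (hb : ∀ t, ‖V t‖ ≤ 1)
    (y' : StrongDual ℝ Y) : Integrable (fun t => y' (V t)) ν := by
  refine Integrable.of_bound (C := ‖y'‖) ?_ (Eventually.of_forall fun t => ?_)
  · exact (y'.continuous.measurable.comp hm).aestronglyMeasurable
  · refine (y'.le_opNorm _).trans ?_
    exact mul_le_of_le_one_right (norm_nonneg _) (hb t)

theorem aux_S2 {Y : Type*} [NormedAddCommGroup Y] [NormedSpace ℝ Y]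
    [CompleteSpace Y] [SecondCountableTopology Y] [MeasurableSpace Y] [BorelSpace Y]
    (ν : Measure ℝ) [IsFiniteMeasure ν]
    (d : ℕ → StrongDual ℝ Y) (hd1 : ∀ j, ‖d j‖ ≤ 1) (hd : ∀ y, (∀ j, d j y = 0) → y = 0)
    (s : ℕ → ℝ → Y) (hm : ∀ n, Measurable (s n)) (hb : ∀ n t, ‖s n t‖ ≤ 1)
    (hC : ∀ᵐ t ∂ν, ∃ C : Set (WeakSpace ℝ Y), IsCompact C ∧
      ∀ u ∈ convexHull ℝ (range fun n => s n t), toWeakSpace ℝ Y u ∈ C) :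
    ∃ w : ℝ → Y, Measurable w ∧ (∀ t, ‖w t‖ ≤ 1) ∧
      ∀ (y' : StrongDual ℝ Y) (A : Set ℝ) (c : ℝ),
        Tendsto (fun k => ∫ t in A, y' (s k t) ∂ν) atTop (𝓝 c) → ∫ t in A, y' (w t) ∂ν = c := by
  let κ : Measure ℕ := (Measure.count : Measure ℕ).toFinite
  let π : Measure (ℝ × ℕ) := ν.prod κ
  have hGm : ∀ V : ℝ → Y, Measurable V → Measurable fun q : ℝ × ℕ => d q.2 (V q.1) := by
    intro V hV
    refine measurable_from_prod_countable_left fun j => ?_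
    exact (d j).continuous.measurable.comp hV
  have hGb : ∀ V : ℝ → Y, (∀ t, ‖V t‖ ≤ 1) → ∀ q : ℝ × ℕ, ‖d q.2 (V q.1)‖ ≤ 1 := by
    intro V hV q
    refine ((d q.2).le_opNorm _).trans ?_
    exact mul_le_one₀ (hd1 _) (norm_nonneg _) (hV _)
  have hG : ∀ n, MemLp (fun q : ℝ × ℕ => d q.2 (s n q.1)) 2 π := fun n =>
    MemLp.of_bound (hGm _ (hm n)).aestronglyMeasurable 1 (Eventually.of_forall (hGb _ (hb n)))
  let x : ℕ → Lp ℝ 2 π := fun n => (hG n).toLp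
  obtain ⟨u, p, hu, hp⟩ := aux_hilbert x _ (fun n =>
    Lp.norm_le_of_ae_bound zero_le_one (by
      filter_upwards [(hG n).coeFn_toLp] with q hq
      change ‖((hG n).toLp) q‖ ≤ 1
      rw [hq]
      exact hGb _ (hb n) q))
  have hex : ∀ k, ∃ V ∈ convexHull ℝ (s '' Ici k), u k =ᵐ[π] fun q : ℝ × ℕ => d q.2 (V q.1) := by
    intro k
    have hconv : Convex ℝ {z : Lp ℝ 2 π | ∃ V ∈ convexHull ℝ (s '' Ici k),
        z =ᵐ[π] fun q : ℝ × ℕ => d q.2 (V q.1)} := by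
      rintro z ⟨V, hV, hz⟩ z' ⟨V', hV', hz'⟩ a b ha hb hab
      refine ⟨a • V + b • V', convex_convexHull ℝ _ hV hV' ha hb hab, ?_⟩
      filter_upwards [Lp.coeFn_add (a • z) (b • z'), Lp.coeFn_smul a z, Lp.coeFn_smul b z', hz, hz']
        with q h1 h2 h3 h4 h5
      rw [h1, Pi.add_apply, h2, h3, Pi.smul_apply, Pi.smul_apply, h4, h5]
      simp
    refine convexHull_min ?_ hconv (hu k)
    rintro _ ⟨n, hn, rfl⟩
    exact ⟨s n, subset_convexHull _ _ ⟨n, hn, rfl⟩, (hG n).coeFn_toLp⟩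
  choose U hU hUu using hex
  have hUp := fun k => aux_conv_meas s hm hb k (U k) (hU k)
  obtain ⟨ns, hns, hlim⟩ := (tendstoInMeasure_of_tendsto_Lp hp).exists_seq_tendsto_ae
  have h1 : ∀ᵐ q ∂π, ∃ l, Tendsto (fun i => d q.2 (U (ns i) q.1)) atTop (𝓝 l) := by
    filter_upwards [hlim, ae_all_iff.2 hUu] with q hq1 hq2
    refine ⟨_, hq1.congr fun i => hq2 (ns i)⟩
  have h2 : ∀ᵐ t ∂ν, ∀ j, ∃ l, Tendsto (fun i => d j (U (ns i) t)) atTop (𝓝 l) := by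
    filter_upwards [Measure.ae_ae_of_ae_prod h1] with t ht
    have : ∀ᵐ j ∂(Measure.count : Measure ℕ),
        ∃ l, Tendsto (fun i => d j (U (ns i) t)) atTop (𝓝 l) := by
      rw [Filter.Eventually, ← ae_toFinite]
      exact ht
    exact Measure.ae_count_iff.1 this
  have h3 : ∀ᵐ t ∂ν, ∃ w, ∀ y' : StrongDual ℝ Y,
      Tendsto (fun i => y' (U (ns i) t)) atTop (𝓝 (y' w)) := by
    filter_upwards [h2, hC] with t ht1 ⟨C, hCc, hC⟩
    exact aux_lim d hd C hCc _ (fun k => hC _ ((hUp (ns k)).2.2 t)) ht1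
  obtain ⟨T, hTae, hTm, hT⟩ := h3.exists_measurable_mem
  have h4 : ∀ t, ∃ w, ∀ y' : StrongDual ℝ Y,
      Tendsto (fun i => T.indicator (fun t => y' (U (ns i) t)) t) atTop (𝓝 (y' w)) := by
    intro t
    by_cases ht : t ∈ T
    · simpa [ht] using hT t ht
    · refine ⟨0, fun y' => ?_⟩
      simp [ht]
  choose w hw using h4
  have hwm : Measurable w := by
    refine aux_meas d hd w fun j => ?_
    refine measurable_of_tendsto_metrizable (f := fun i t =>
      T.indicator (fun t => d j (U (ns i) t)) t) (fun i => ?_) (tendsto_pi_nhds.2 fun t => hw t (d j))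
    exact ((d j).continuous.measurable.comp (hUp _).1).indicator hTm
  have hwb : ∀ t, ‖w t‖ ≤ 1 := by
    intro t
    obtain ⟨g, hg1, hg2⟩ := exists_dual_vector'' ℝ (w t)
    have h5 := hw t g
    have h6 : g (w t) ≤ 1 := by
      refine le_of_tendsto h5 (Eventually.of_forall fun i => ?_)
      by_cases ht : t ∈ T
      · simp only [ht, indicator_of_mem]
        refine (le_abs_self _).trans ((g.le_opNorm _).trans ?_)
        exact mul_le_one₀ hg1 (norm_nonneg _) ((hUp _).2.1 t)
      · simp [ht]
    rw [hg2] at h6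
    simpa using h6
  refine ⟨w, hwm, hwb, fun y' A c hc => ?_⟩
  have hae : ∀ᵐ t ∂(ν.restrict A), Tendsto (fun i => y' (U (ns i) t)) atTop (𝓝 (y' (w t))) := by
    refine ae_restrict_of_ae ?_
    filter_upwards [hTae] with t ht
    simpa [ht] using hw t y'
  have l1 : Tendsto (fun i => ∫ t in A, y' (U (ns i) t) ∂ν) atTop (𝓝 (∫ t in A, y' (w t) ∂ν)) := by
    refine tendsto_integral_of_dominated_convergence (fun _ => ‖y'‖) (fun i => ?_)
      (integrable_const _) (fun i => Eventually.of_forall fun t => ?_) hae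
    · exact (aux_int _ _ (hUp _).1 (hUp _).2.1 y').aestronglyMeasurable
    · refine (y'.le_opNorm _).trans ?_
      exact mul_le_of_le_one_right (norm_nonneg _) ((hUp _).2.1 t)
  have l2 : Tendsto (fun k => ∫ t in A, y' (U k t) ∂ν) atTop (𝓝 c) := by
    rw [Metric.tendsto_atTop']
    intro ε hε
    obtain ⟨N, hN⟩ := Metric.tendsto_atTop.1 hc ε hε
    refine ⟨N, fun k hk => ?_⟩
    have hconv : Convex ℝ {V : ℝ → Y | Integrable (fun t => y' (V t)) (ν.restrict A) ∧
        ∫ t in A, y' (V t) ∂ν ∈ Metric.ball c ε} := by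
      rintro V ⟨a1, a2⟩ W ⟨b1, b2⟩ a b ha hb hab
      have e : (fun t => y' ((a • V + b • W) t)) = fun t => a • y' (V t) + b • y' (W t) := by
        ext t; simp
      refine ⟨?_, ?_⟩
      · rw [e]; exact (a1.smul a).add (b1.smul b)
      · rw [e, integral_add (f := fun t => a • y' (V t)) (g := fun t => b • y' (W t))
          (a1.smul a) (b1.smul b), integral_smul, integral_smul]
        exact convex_ball c ε a2 b2 ha hb hab
    have := convexHull_min (s := s '' Ici k) ?_ hconv (hU k)
    · exact this.2
    · rintro _ ⟨n, hn, rfl⟩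
      exact ⟨aux_int _ _ (hm n) (hb n) y', hN n (le_trans hk.le hn)⟩
  exact tendsto_nhds_unique l1 (l2.comp hns.tendsto_atTop)

theorem aux_subseq {Y : Type*} [NormedAddCommGroup Y] [NormedSpace ℝ Y]
    [SecondCountableTopology Y] [MeasurableSpace Y] [BorelSpace Y]
    (ν : Measure ℝ) [IsFiniteMeasure ν]
    (d : ℕ → StrongDual ℝ Y) (hd1 : ∀ j, ‖d j‖ ≤ 1)
    (s : ℕ → ℝ → Y) (hm : ∀ n, Measurable (s n)) (hb : ∀ n t, ‖s n t‖ ≤ 1) :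
    ∃ φ : ℕ → ℕ, StrictMono φ ∧ ∀ j (A : Set ℝ), MeasurableSet A →
      ∃ c, Tendsto (fun k => ∫ t in A, d j (s (φ k) t) ∂ν) atTop (𝓝 c) := by
  let κ : Measure ℕ := (Measure.count : Measure ℕ).toFinite
  let π : Measure (ℝ × ℕ) := ν.prod κ
  have hGm : ∀ V : ℝ → Y, Measurable V → Measurable fun q : ℝ × ℕ => d q.2 (V q.1) := by
    intro V hV
    refine measurable_from_prod_countable_left fun j => ?_
    exact (d j).continuous.measurable.comp hV
  have hGb : ∀ V : ℝ → Y, (∀ t, ‖V t‖ ≤ 1) → ∀ q : ℝ × ℕ, ‖d q.2 (V q.1)‖ ≤ 1 := by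
    intro V hV q
    refine ((d q.2).le_opNorm _).trans ?_
    exact mul_le_one₀ (hd1 _) (norm_nonneg _) (hV _)
  have hG : ∀ n, MemLp (fun q : ℝ × ℕ => d q.2 (s n q.1)) 2 π := fun n =>
    MemLp.of_bound (hGm _ (hm n)).aestronglyMeasurable 1 (Eventually.of_forall (hGb _ (hb n)))
  let x : ℕ → Lp ℝ 2 π := fun n => (hG n).toLp
  obtain ⟨M, hM⟩ : ∃ M, ∀ n, ‖x n‖ ≤ M := ⟨_, fun n =>
    Lp.norm_le_of_ae_bound zero_le_one (by
      filter_upwards [(hG n).coeFn_toLp] with q hq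
      change ‖((hG n).toLp) q‖ ≤ 1
      rw [hq]
      exact hGb _ (hb n) q)⟩
  have : Fact ((1 : ENNReal) ≤ 2) := ⟨by norm_num⟩
  have : Fact ((2 : ENNReal) ≠ ⊤) := ⟨by norm_num⟩
  have hsc := WeakDual.isSeqCompact_closedBall ℝ (Lp ℝ 2 π) 0 M
  obtain ⟨a, -, φ, hφ, ha⟩ := hsc
    (x := fun n => StrongDual.toWeakDual (innerSL ℝ (x n))) (fun n => by
      simp only [mem_preimage, mem_closedBall_zero_iff]
      change ‖innerSL ℝ (x n)‖ ≤ M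
      simpa using hM n)
  refine ⟨φ, hφ, fun j A hA => ?_⟩
  have hκj : κ.real {j} ≠ 0 := by
    intro h0
    have h1 : κ {j} = 0 := (measureReal_eq_zero_iff).1 h0
    have h2 : (Measure.count : Measure ℕ) {j} = 0 := absolutelyContinuous_toFinite _ h1
    simp at h2
  have hms : MeasurableSet (A ×ˢ ({j} : Set ℕ)) := hA.prod (measurableSet_singleton j)
  have h3 := ((WeakDual.eval_continuous (indicatorConstLp 2 hms (measure_ne_top π _) (1 : ℝ))).tendsto a).comp ha
  have h4 : ∀ n, (innerSL ℝ (x n)) (indicatorConstLp 2 hms (measure_ne_top π _) (1 : ℝ)) =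
      κ.real {j} * ∫ t in A, d j (s n t) ∂ν := by
    intro n
    rw [innerSL_apply_apply, real_inner_comm, L2.inner_indicatorConstLp_one]
    have e1 : ∫ q in A ×ˢ ({j} : Set ℕ), (x n) q ∂π =
        ∫ q in A ×ˢ ({j} : Set ℕ), d q.2 (s n q.1) ∂π :=
      integral_congr_ae (ae_restrict_of_ae (hG n).coeFn_toLp)
    rw [e1, setIntegral_prod _ ((hG n).integrable (by norm_num)).integrableOn, ← integral_const_mul]
    congr 1
    ext t
    simp [Measure.real]
  refine ⟨(κ.real {j})⁻¹ * a (indicatorConstLp 2 hms (measure_ne_top π _) (1 : ℝ)), ?_⟩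
  refine (h3.const_mul (κ.real {j})⁻¹).congr fun k => ?_
  have := h4 (φ k)
  simp only [Function.comp_apply]
  change _ * (innerSL ℝ (x (φ k))) _ = _
  rw [this, inv_mul_cancel_left₀ hκj]

theorem aux_core {Y : Type*} [NormedAddCommGroup Y] [NormedSpace ℝ Y]
    [CompleteSpace Y] [SecondCountableTopology Y] [MeasurableSpace Y] [BorelSpace Y]
    (ν : Measure ℝ) [IsFiniteMeasure ν]
    (s : ℕ → ℝ → Y) (hm : ∀ n, Measurable (s n)) (hb : ∀ n t, ‖s n t‖ ≤ 1)
    (hC : ∀ᵐ t ∂ν, ∃ C : Set (WeakSpace ℝ Y), IsCompact C ∧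
      ∀ u ∈ convexHull ℝ (range fun n => s n t), toWeakSpace ℝ Y u ∈ C) :
    ∃ (w : ℝ → Y) (φ : ℕ → ℕ), StrictMono φ ∧ Measurable w ∧ (∀ t, ‖w t‖ ≤ 1) ∧
      ∀ (y' : StrongDual ℝ Y) (A : Set ℝ), MeasurableSet A →
        Tendsto (fun k => ∫ t in A, y' (s (φ k) t) ∂ν) atTop (𝓝 (∫ t in A, y' (w t) ∂ν)) := by
  obtain ⟨d, hd1, hd⟩ := aux_sep Y
  obtain ⟨φ, hφ, hlim⟩ := aux_subseq ν d hd1 s hm hb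
  have hCs : ∀ ψ : ℕ → ℕ, ∀ᵐ t ∂ν, ∃ C : Set (WeakSpace ℝ Y), IsCompact C ∧
      ∀ u ∈ convexHull ℝ (range fun n => s (ψ n) t), toWeakSpace ℝ Y u ∈ C := by
    intro ψ
    filter_upwards [hC] with t ⟨C, h1, h2⟩
    refine ⟨C, h1, fun u hu => h2 u (convexHull_mono ?_ hu)⟩
    rintro _ ⟨n, rfl⟩
    exact ⟨ψ n, rfl⟩
  obtain ⟨w, hwm, hwb, hw⟩ := aux_S2 ν d hd1 hd (fun k => s (φ k)) (fun k => hm _) (fun k => hb _)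
    (hCs φ)
  refine ⟨w, φ, hφ, hwm, hwb, fun y' A hA => ?_⟩
  refine tendsto_of_subseq_tendsto fun ns hns => ?_
  obtain ⟨c, -, ms, hms, hc⟩ := tendsto_subseq_of_bounded
    (Metric.isBounded_closedBall (x := (0 : ℝ)) (r := ‖y'‖ * ν.real A))
    (x := fun i => ∫ t in A, y' (s (φ (ns i)) t) ∂ν) (fun i => by
      rw [mem_closedBall_zero_iff]
      refine norm_setIntegral_le_of_norm_le_const (measure_lt_top _ _) fun t _ => ?_
      refine (y'.le_opNorm _).trans ?_
      exact mul_le_of_le_one_right (norm_nonneg _) (hb _ t))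
  refine ⟨ms, ?_⟩
  obtain ⟨w', hwm', hwb', hw'⟩ := aux_S2 ν d hd1 hd (fun k => s (φ (ns (ms k)))) (fun k => hm _)
    (fun k => hb _) (hCs fun k => φ (ns (ms k)))
  have hsub : Tendsto (fun k => ns (ms k)) atTop atTop := hns.comp hms.tendsto_atTop
  have hj : ∀ j, ∀ᵐ t ∂ν, d j (w t) = d j (w' t) := by
    intro j
    refine Integrable.ae_eq_of_forall_setIntegral_eq _ _ (aux_int ν w hwm hwb (d j))
      (aux_int ν w' hwm' hwb' (d j)) fun B hB _ => ?_
    obtain ⟨c', hc'⟩ := hlim j B hB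
    rw [hw (d j) B c' hc', hw' (d j) B c' (hc'.comp hsub)]
  have hww : ∀ᵐ t ∂ν, w t = w' t := by
    filter_upwards [ae_all_iff.2 hj] with t ht
    rw [← sub_eq_zero]
    exact hd _ fun j => by simp [ht j]
  have : ∫ t in A, y' (w t) ∂ν = c := by
    rw [← hw' y' A c hc]
    refine integral_congr_ae (ae_restrict_of_ae ?_)
    filter_upwards [hww] with t ht
    rw [ht]
  rw [this]
  exact hc

theorem aux_ext {X : Type*} [NormedAddCommGroup X] [NormedSpace ℝ X]
    (ν : Measure ℝ) [IsFiniteMeasure ν] (D : ℕ → ℝ → X) (hD : ∀ k, AEStronglyMeasurable (D k) ν)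
    (hb : ∀ k t, ‖D k t‖ ≤ 2)
    (h : ∀ (c : X →L[ℝ] ℝ) (A : Set ℝ), MeasurableSet A →
      Tendsto (fun k => ∫ t in A, c (D k t) ∂ν) atTop (𝓝 0))
    (g : ℝ → (X →L[ℝ] ℝ)) (hg : Integrable g ν) :
    Tendsto (fun k => ∫ t, g t (D k t) ∂ν) atTop (𝓝 0) := by
  have hbd : ∀ (g : ℝ → (X →L[ℝ] ℝ)) k t, ‖g t (D k t)‖ ≤ ‖g t‖ * 2 := fun g k t =>
    ((g t).le_opNorm _).trans (mul_le_mul_of_nonneg_left (hb k t) (norm_nonneg _))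
  have hint : ∀ (g : ℝ → (X →L[ℝ] ℝ)), Integrable g ν → ∀ k, Integrable (fun t => g t (D k t)) ν := by
    intro g hg k
    refine Integrable.mono' (hg.norm.mul_const 2) ?_ (Eventually.of_forall (hbd g k))
    exact (ContinuousLinearMap.id ℝ (X →L[ℝ] ℝ)).aestronglyMeasurable_comp₂ hg.1 (hD k)
  refine Integrable.induction (fun g : ℝ → (X →L[ℝ] ℝ) =>
    Tendsto (fun k => ∫ t, g t (D k t) ∂ν) atTop (𝓝 0)) ?_ ?_ ?_ ?_ hg
  · intro c A hA _
    refine (h c A hA).congr fun k => ?_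
    rw [← integral_indicator hA]
    congr 1
    ext t
    by_cases ht : t ∈ A <;> simp [ht]
  · intro f g _ hf hg h1 h2
    have := h1.add h2
    rw [add_zero] at this
    refine this.congr fun k => ?_
    rw [← integral_add (hint f hf k) (hint g hg k)]
    simp
  · rw [← isSeqClosed_iff_isClosed]
    intro F f hF hlim
    simp only [mem_ofPred_eq] at hF ⊢
    rw [Metric.tendsto_atTop]
    intro ε hε
    obtain ⟨N, hN⟩ := Metric.tendsto_atTop.1 hlim (ε / 4) (by positivity)
    obtain ⟨K, hK⟩ := Metric.tendsto_atTop.1 (hF N) (ε / 2) (by positivity)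
    refine ⟨K, fun k hk => ?_⟩
    have h1 := hK k hk
    have h2 := hN N le_rfl
    rw [dist_zero_right] at h1 ⊢
    rw [dist_comm, dist_eq_norm, L1.norm_eq_integral_norm] at h2
    have i1 := L1.integrable_coeFn f
    have i2 := L1.integrable_coeFn (F N)
    have h3 : ‖∫ t, (f t - F N t) (D k t) ∂ν‖ ≤ ∫ t, ‖(f - F N) t‖ * 2 ∂ν := by
      refine norm_integral_le_of_norm_le ((L1.integrable_coeFn _).norm.mul_const 2) ?_
      filter_upwards [Lp.coeFn_sub f (F N)] with t ht
      rw [ht]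
      exact hbd (fun t => f t - F N t) k t
    rw [integral_mul_const] at h3
    have h4 : ∫ t, (f t - F N t) (D k t) ∂ν = ∫ t, f t (D k t) ∂ν - ∫ t, F N t (D k t) ∂ν := by
      rw [← integral_sub (hint _ i1 k) (hint _ i2 k)]
      simp
    have h5 : ∫ t, f t (D k t) ∂ν = ∫ t, (f t - F N t) (D k t) ∂ν + ∫ t, F N t (D k t) ∂ν := by
      rw [h4]; ring
    rw [h5]
    refine (norm_add_le _ _).trans_lt ?_
    linarith
  · intro f g hfg hf h1
    refine h1.congr fun k => integral_congr_ae ?_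
    filter_upwards [hfg] with t ht
    rw [ht]

theorem aux_cpt {X : Type*} [NormedAddCommGroup X] [NormedSpace ℝ X] [CompleteSpace X]
    (Y : Submodule ℝ X) (hY : IsClosed (Y : Set X)) [SecondCountableTopology Y]
    (K : Set X) (hK : IsCompact (toWeakSpace ℝ X '' K)) (a M : ℝ)
    (q : ℕ → Y) (hq : ∀ n, (q n : X) ∈ K) (hqM : ∀ n, ‖(q n : X)‖ ≤ M) :
    ∃ C : Set (WeakSpace ℝ Y), IsCompact C ∧
      ∀ u ∈ convexHull ℝ (range fun n => a • q n), toWeakSpace ℝ Y u ∈ C := by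
  have : CompleteSpace Y := hY.completeSpace_coe
  have hcl : ∀ S : Set X, Convex ℝ S → IsClosed S → IsClosed (toWeakSpace ℝ X '' S) := by
    intro S h1 h2
    have := h1.toWeakSpace_closure ℝ
    rw [h2.closure_eq] at this
    rw [this]
    exact isClosed_closure
  let Z : Set (WeakSpace ℝ X) := toWeakSpace ℝ X '' K ∩ toWeakSpace ℝ X '' (Y : Set X) ∩
    toWeakSpace ℝ X '' Metric.closedBall 0 M
  have hZ : IsCompact Z := (hK.inter_right (hcl _ Y.convex hY)).inter_right
    (hcl _ (convex_closedBall _ _) Metric.isClosed_closedBall)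
  have : CompactSpace Z := isCompact_iff_compactSpace.1 hZ
  have hZY : ∀ z : Z, (toWeakSpace ℝ X).symm z ∈ Y := by
    rintro ⟨z, ⟨_, ⟨y, hy, rfl⟩⟩, _⟩
    simpa using hy
  have hZM : ∀ z : Z, ‖(toWeakSpace ℝ X).symm z‖ ≤ M := by
    rintro ⟨z, _, ⟨y, hy, rfl⟩⟩
    simpa using hy
  let f : Z → Y := fun z => a • ⟨(toWeakSpace ℝ X).symm z, hZY z⟩
  obtain ⟨C, hC, hCu⟩ := aux_KS f (‖a‖ * M) (fun z => by
      rw [norm_smul]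
      exact mul_le_mul_of_nonneg_left (hZM z) (norm_nonneg _)) (fun y' => by
      obtain ⟨g, hg, -⟩ := exists_extension_norm_eq Y y'
      have h1 : Continuous fun z : WeakSpace ℝ X => g ((toWeakSpace ℝ X).symm z) :=
        WeakBilin.eval_continuous (topDualPairing ℝ X).flip g
      refine ((h1.comp continuous_subtype_val).const_smul a).congr fun z => ?_
      rw [← hg]
      exact (g.map_smul a _).symm)
  refine ⟨C, hC, fun u hu => hCu u (convexHull_mono ?_ hu)⟩
  rintro _ ⟨n, rfl⟩
  exact ⟨⟨toWeakSpace ℝ X (q n), ⟨⟨_, hq n, rfl⟩, ⟨_, (q n).2, rfl⟩⟩,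
    ⟨_, by simpa using hqM n, rfl⟩⟩, rfl⟩




/-- **A weak compactness criterion for Bochner integrable maps**
(Diestel–Ruess–Schachermayer). Let `(v_n) ⊂ L¹(I,X)` be dominated by `m ∈ L¹(I,ℝ₊)` and
pointwise a.e. contained in a family of weakly compact sets `K_t ⊆ X`. Then a subsequence
converges weakly in `L¹(I,X)`; in particular `∫_I ⟨φ(t), v(t) − v_{n_k}(t)⟩ dt → 0` for
every `φ ∈ L^∞(I, X*)`. -/
theorem weak_L1_compactness_criterion
    {X : Type*} [NormedAddCommGroup X] [NormedSpace ℝ X] [CompleteSpace X]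
    (I : Set ℝ) (hI : I.OrdConnected) (hImeas : MeasurableSet I)
    (v : ℕ → ℝ → X)
    (hint : ∀ n, IntegrableOn (v n) I)
    (m : ℝ → ℝ) (hm : IntegrableOn m I) (hm0 : ∀ t, 0 ≤ m t)
    (K : ℝ → Set X)
    (hK : ∀ t ∈ I, IsCompact (toWeakSpace ℝ X '' K t))
    (hdom : ∀ n, ∀ᵐ t ∂(volume.restrict I), ‖v n t‖ ≤ m t ∧ v n t ∈ K t) :
    ∃ (w : ℝ → X) (φ : ℕ → ℕ), StrictMono φ ∧ IntegrableOn w I ∧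
      ∀ g : ℝ → (X →L[ℝ] ℝ),
        AEStronglyMeasurable g (volume.restrict I) →
        (∃ C : ℝ, ∀ᵐ t ∂(volume.restrict I), ‖g t‖ ≤ C) →
        Tendsto (fun k => ∫ t in I, g t (w t - v (φ k) t)) atTop (nhds 0) := by
  classical
  let _ : MeasurableSpace X := borel X
  have _ : BorelSpace X := ⟨rfl⟩
  set μ : Measure ℝ := volume.restrict I with hμ
  have hint' : ∀ n, Integrable (v n) μ := hint
  have hm' : Integrable m μ := hm
  -- measurable versions
  let v' : ℕ → ℝ → X := fun n => (hint' n).1.mk (v n)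
  have hv'm : ∀ n, StronglyMeasurable (v' n) := fun n => (hint' n).1.stronglyMeasurable_mk
  have hv'e : ∀ n, v n =ᵐ[μ] v' n := fun n => (hint' n).1.ae_eq_mk
  let M : ℝ → ℝ := fun t => max (hm'.1.mk m t) 0
  have hMm : Measurable M := hm'.1.stronglyMeasurable_mk.measurable.max measurable_const
  have hM0 : ∀ t, 0 ≤ M t := fun t => le_max_right _ _
  have hMe : m =ᵐ[μ] M := by
    filter_upwards [hm'.1.ae_eq_mk] with t ht
    simp only [M, ← ht, max_eq_left (hm0 t)]
  have hMi : Integrable M μ := hm'.congr hMe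
  -- separable subspace
  let Y : Submodule ℝ X := (Submodule.span ℝ (⋃ n, range (v' n))).topologicalClosure
  have hYc : IsClosed (Y : Set X) := Submodule.isClosed_topologicalClosure _
  have hYs : TopologicalSpace.IsSeparable (Y : Set X) := by
    have h1 : TopologicalSpace.IsSeparable (⋃ n, range (v' n)) :=
      TopologicalSpace.IsSeparable.iUnion fun n => (hv'm n).isSeparable_range
    have h2 := h1.span (R := ℝ)
    simpa [Y, Submodule.topologicalClosure_coe] using h2.closure
  have : TopologicalSpace.SeparableSpace Y := hYs.separableSpace
  have : SecondCountableTopology Y := UniformSpace.secondCountable_of_separable Y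
  have : CompleteSpace Y := hYc.completeSpace_coe
  have hvY : ∀ n t, v' n t ∈ Y := fun n t =>
    Submodule.le_topologicalClosure _ (Submodule.subset_span (mem_iUnion.2 ⟨n, t, rfl⟩))
  let vY : ℕ → ℝ → Y := fun n t => ⟨v' n t, hvY n t⟩
  have hvYm : ∀ n, Measurable (vY n) := fun n => (hv'm n).measurable.subtype_mk
  let r : ℕ → ℝ → Y := fun n t => if ‖vY n t‖ ≤ M t then (M t)⁻¹ • vY n t else 0
  have hrm : ∀ n, Measurable (r n) := fun n =>
    Measurable.ite (measurableSet_le (hvYm n).norm hMm) (hMm.inv.smul (hvYm n)) measurable_const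
  have hrb : ∀ n t, ‖r n t‖ ≤ 1 := by
    intro n t
    by_cases h : ‖vY n t‖ ≤ M t
    · simp only [r, if_pos h, norm_smul, norm_inv, Real.norm_of_nonneg (hM0 t)]
      exact inv_mul_le_one_of_le₀ h (hM0 t)
    · have h0 : r n t = 0 := if_neg h
      rw [h0, norm_zero]
      exact zero_le_one
  -- the weighted finite measure
  let ν : Measure ℝ := μ.withDensity fun t => ENNReal.ofReal (M t)
  have : IsFiniteMeasure ν := isFiniteMeasure_withDensity_ofReal hMi.2
  have hac : ν ≪ μ := withDensity_absolutelyContinuous _ _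
  have hgood : ∀ᵐ t ∂μ, t ∈ I ∧ ∀ n, v n t = v' n t ∧ ‖vY n t‖ ≤ M t ∧ v' n t ∈ K t := by
    filter_upwards [ae_restrict_mem hImeas, ae_all_iff.2 hv'e, ae_all_iff.2 hdom, hMe]
      with t h1 h2 h3 h4
    refine ⟨h1, fun n => ⟨h2 n, ?_, ?_⟩⟩
    · change ‖v' n t‖ ≤ M t
      rw [← h2 n, ← h4]
      exact (h3 n).1
    · rw [← h2 n]
      exact (h3 n).2
  have hC : ∀ᵐ t ∂ν, ∃ C : Set (WeakSpace ℝ Y), IsCompact C ∧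
      ∀ u ∈ convexHull ℝ (range fun n => r n t), toWeakSpace ℝ Y u ∈ C := by
    filter_upwards [hac.ae_le hgood] with t ⟨htI, ht⟩
    have e : (fun n => r n t) = fun n => (M t)⁻¹ • vY n t := by
      ext n
      simp only [r, if_pos (ht n).2.1]
    rw [e]
    exact aux_cpt Y hYc (K t) (hK t htI) _ (M t) (fun n => vY n t) (fun n => (ht n).2.2)
      (fun n => (ht n).2.1)
  obtain ⟨ω, φ, hφ, hωm, hωb, hω⟩ := aux_core ν r hrm hrb hC
  have hXm : ∀ V : ℝ → Y, Measurable V → StronglyMeasurable fun t => (V t : X) := fun V hV =>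
    Y.subtypeL.continuous.comp_stronglyMeasurable hV.stronglyMeasurable
  refine ⟨fun t => M t • (ω t : X), φ, hφ, ?_, ?_⟩
  · refine Integrable.mono' hMi ?_ (Eventually.of_forall fun t => ?_)
    · exact (hMm.stronglyMeasurable.smul (hXm ω hωm)).aestronglyMeasurable
    · rw [norm_smul, Real.norm_of_nonneg (hM0 t)]
      exact mul_le_of_le_one_right (hM0 t) (hωb t)
  · rintro g hgm ⟨B, hB⟩
    let D : ℕ → ℝ → X := fun k t => (ω t : X) - (r (φ k) t : X)
    have hDm : ∀ k, StronglyMeasurable (D k) := fun k => (hXm _ hωm).sub (hXm _ (hrm _))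
    have hDb : ∀ k t, ‖D k t‖ ≤ 2 := fun k t => by
      refine (norm_sub_le _ _).trans ?_
      have h1 : ‖(ω t : X)‖ ≤ 1 := hωb t
      have h2 : ‖(r (φ k) t : X)‖ ≤ 1 := hrb (φ k) t
      linarith
    have hgi : Integrable g ν := Integrable.of_bound (hgm.mono_ac hac) B (hac.ae_le hB)
    have hlim := aux_ext ν D (fun k => (hDm k).aestronglyMeasurable) hDb (fun c A hA => by
      have h1 := hω (c.comp Y.subtypeL) A hA
      have h2 := (tendsto_const_nhds (x := ∫ t in A, (c.comp Y.subtypeL) (ω t) ∂ν)).sub h1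
      rw [sub_self] at h2
      refine h2.congr fun k => ?_
      rw [← integral_sub (aux_int _ _ hωm hωb _) (aux_int _ _ (hrm _) (hrb _) _)]
      simp [D]) g hgi
    refine hlim.congr fun k => ?_
    rw [integral_withDensity_eq_integral_toReal_smul hMm.ennreal_ofReal
      (Eventually.of_forall fun t => ENNReal.ofReal_lt_top)]
    refine integral_congr_ae ?_
    filter_upwards [hgood] with t ⟨_, ht⟩
    obtain ⟨h1, h2, -⟩ := ht (φ k)
    rw [ENNReal.toReal_ofReal (hM0 t), ← map_smul]
    congr 1
    simp only [D, smul_sub, r, if_pos h2]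
    congr 1
    rw [h1]
    change M t • ((M t)⁻¹ • v' (φ k) t) = v' (φ k) t
    rcases (hM0 t).eq_or_lt with h0 | h0
    · have h3 : ‖v' (φ k) t‖ ≤ M t := h2
      rw [← h0] at h3
      rw [norm_le_zero_iff.1 h3]
      simp
    · exact smul_inv_smul₀ h0.ne' _
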